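/- Let D be a bounded domain in ℂⁿ and suppose A = ⋃_{j=1}^∞ A_j where each A_j ⊆ ∂D. If ω*(x, A_j, D) = 0 for every x ∈ cl(D) and every j, then ω*(x, A, D) = 0 for every x ∈ cl(D). Consequently, a countable union of b-pluripolar subsets of ∂D is b-pluripolar. -/

import Mathlib

open Complex Metric MeasureTheory Filter Topology Set

noncomputable section

/-- The average of the truncation `max u (-m)` of an `EReal`-valued function `u` over the
circle of center `c` and radius `r`. -/
noncomputable def truncCircleAvg (u : ℂ → EReal) (c : ℂ) (r : ℝ) (m : ℕ) : ℝ :=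
  (2 * Real.pi)⁻¹ *
    ∫ θ in (0:ℝ)..(2 * Real.pi),
      (max (u (c + (r : ℂ) * Complex.exp (θ * Complex.I))) ((-(m : ℝ) : ℝ) : EReal)).toReal

/-- A `[-∞,∞]`-valued function is subharmonic on `U ⊆ ℂ` if it is upper semicontinuous
on `U` and satisfies the sub-mean value inequality on every closed disc contained in `U`
(expressed via averages of truncations from below). -/
def SubharmonicOn (u : ℂ → EReal) (U : Set ℂ) : Prop :=
  UpperSemicontinuousOn u U ∧
    ∀ c r, 0 < r → Metric.closedBall c r ⊆ U →
      ∀ m : ℕ, u c ≤ ((truncCircleAvg u c r m : ℝ) : EReal)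

variable {E : Type*} [NormedAddCommGroup E] [NormedSpace ℂ E]

/-- Plurisubharmonic on `D`: upper semicontinuous on `D`, with values in `[-∞, ∞)`,
whose restriction to every complex line is subharmonic.  (The constant `-∞` is allowed
here; the paper's class `PSH(D)` additionally requires `u ≢ -∞`, see `MemPSH`.) -/
def PshOn (u : E → EReal) (D : Set E) : Prop :=
  UpperSemicontinuousOn u D ∧ (∀ z ∈ D, u z ≠ ⊤) ∧
    ∀ a b : E, SubharmonicOn (fun ζ : ℂ => u (a + ζ • b)) {ζ : ℂ | a + ζ • b ∈ D}

/-- Membership in the paper's class `PSH(D)`: plurisubharmonic and not identically `-∞`. -/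
def MemPSH (u : E → EReal) (D : Set E) : Prop :=
  PshOn u D ∧ ∃ z ∈ D, u z ≠ ⊥

/-- The upper semicontinuous regularization `u*` of `u` on `cl(D)`:
`u*(x) = limsup_{z → x, z ∈ D} u(z)`. -/
noncomputable def uscReg (u : E → EReal) (D : Set E) (x : E) : EReal :=
  Filter.limsup u (nhdsWithin x D)

/-- The boundary relative extremal function
`ω(z, A, D) = sup { u(z) : u ∈ PSH(D), u ≤ 0 on D, u* ≤ -1 on A }`. -/
noncomputable def bndExt (z : E) (A D : Set E) : EReal :=
  sSup {w : EReal | ∃ u : E → EReal, MemPSH u D ∧ (∀ y ∈ D, u y ≤ 0) ∧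
    (∀ x ∈ A, uscReg u D x ≤ -1) ∧ w = u z}

/-- The upper semicontinuous regularization `ω*(·, A, D)` on `cl(D)`. -/
noncomputable def bndExtStar (x : E) (A D : Set E) : EReal :=
  Filter.limsup (fun z => bndExt z A D) (nhdsWithin x D)

/-- A bounded domain: a nonempty connected bounded open set. -/
def IsBddDomain (D : Set E) : Prop :=
  IsOpen D ∧ IsConnected D ∧ Bornology.IsBounded D

/-- `A ⊆ ∂D` is b-pluripolar if there is `u ∈ PSH(D)`, `u ≤ 0`, `u ≢ -∞`,
with `u* = -∞` on `A`. -/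
def BPluripolar (A D : Set E) : Prop :=
  ∃ u : E → EReal, PshOn u D ∧ (∀ z ∈ D, u z ≤ 0) ∧ (∃ z ∈ D, u z ≠ ⊥) ∧
    ∀ x ∈ A, uscReg u D x = ⊥

/-- The b-pluripolar hull `Â` of `A ⊆ ∂D`: all points `z ∈ cl(D)` such that `u*(z) = -∞`
for every negative `u ∈ PSH(D)`, `u ≢ -∞`, with `u* = -∞` on `A`. -/
def bHull (A D : Set E) : Set E :=
  {z ∈ closure D | ∀ u : E → EReal, PshOn u D → (∀ y ∈ D, u y < 0) →
    (∃ y ∈ D, u y ≠ ⊥) → (∀ x ∈ A, uscReg u D x = ⊥) → uscReg u D z = ⊥}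

/-- Weak regularity: for every relatively open `U ⊆ ∂D` one has `ω*(·, U, D) ≤ -1` on `U`. -/
def WeaklyRegular (D : Set E) : Prop :=
  ∀ U W : Set E, IsOpen W → U = W ∩ frontier D → ∀ x ∈ U, bndExtStar x U D ≤ -1

/-- B-regularity (Sibony): every continuous `f : ∂D → ℝ` extends to a function
plurisubharmonic on `D` and continuous on `cl(D)` with boundary values `f`. -/
def BRegular (D : Set E) : Prop :=
  ∀ f : E → ℝ, ContinuousOn f (frontier D) →
    ∃ F : E → ℝ, ContinuousOn F (closure D) ∧
      PshOn (fun z => ((F z : ℝ) : EReal)) D ∧ ∀ x ∈ frontier D, F x = f x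

/-- The extremal function `ω₁(z, K, D)`, defined with continuous-up-to-the-boundary
plurisubharmonic competitors. -/
noncomputable def bndExtCont (z : E) (K D : Set E) : EReal :=
  sSup {w : EReal | ∃ F : E → ℝ, ContinuousOn F (closure D) ∧
    PshOn (fun y => ((F y : ℝ) : EReal)) D ∧ (∀ y ∈ closure D, F y ≤ 0) ∧
    (∀ x ∈ K, F x ≤ -1) ∧ w = ((F z : ℝ) : EReal)}

end

/-- Nonnegative plurisuperharmonic functions, extended to the whole space. -/
def NSuper {n : ℕ} (f : EuclideanSpace ℂ (Fin n) → ENNReal)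
    (D : Set (EuclideanSpace ℂ (Fin n))) : Prop :=
  LowerSemicontinuous f ∧ ∀ a b : EuclideanSpace ℂ (Fin n),
    (∀ ζ : ℂ, ‖ζ‖ ≤ 1 → a + ζ • b ∈ D) →
    ∫⁻ θ in Ioc (0:ℝ) (2 * Real.pi), f (a + Complex.exp (θ * Complex.I) • b)
      ≤ ENNReal.ofReal (2 * Real.pi) * f a

theorem trunc_toReal (g : ENNReal) (m : ℕ) :
    (max (-(g : EReal)) ((-(m : ℝ) : ℝ) : EReal)).toReal = -(min g (m : ENNReal)).toReal := by
  induction g with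
  | top =>
    rw [EReal.coe_ennreal_top, EReal.neg_top, max_eq_right bot_le, EReal.toReal_coe,
      min_eq_right le_top, ENNReal.toReal_natCast]
  | coe x =>
    have h1 : (((x : NNReal) : ENNReal) : EReal) = (((x : ℝ)) : EReal) := rfl
    have h2 : (m : ENNReal) = (((m : NNReal)) : ENNReal) := by simp
    rw [h1, h2, ← ENNReal.coe_min, ENNReal.coe_toReal, ← EReal.coe_neg, (EReal.coe_strictMono.monotone.map_max).symm,
      EReal.toReal_coe, NNReal.coe_min, max_neg_neg]
    simp

theorem trunc_eq {n : ℕ} {D : Set (EuclideanSpace ℂ (Fin n))}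
    {u : EuclideanSpace ℂ (Fin n) → EReal}
    {f : EuclideanSpace ℂ (Fin n) → ENNReal} (hf : LowerSemicontinuous f)
    (huf : ∀ z ∈ D, u z = -(f z : EReal)) (a b : EuclideanSpace ℂ (Fin n)) (c : ℂ) (r : ℝ)
    (hr : 0 < r) (h : Metric.closedBall c r ⊆ {ζ : ℂ | a + ζ • b ∈ D}) (m : ℕ) :
    truncCircleAvg (fun ζ : ℂ => u (a + ζ • b)) c r m =
      -((2 * Real.pi)⁻¹ * (∫⁻ θ in Ioc (0:ℝ) (2 * Real.pi),
        min (f ((a + c • b) + Complex.exp (θ * Complex.I) • ((r : ℂ) • b))) (m : ENNReal)).toReal) := by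
  have hmeas : Measurable (fun θ : ℝ =>
      min (f ((a + c • b) + Complex.exp (θ * Complex.I) • ((r : ℂ) • b))) (m : ENNReal)) := by
    apply Measurable.min _ measurable_const
    apply hf.measurable.comp
    apply Continuous.measurable
    fun_prop
  unfold truncCircleAvg
  rw [intervalIntegral.integral_of_le (by positivity), ← integral_toReal hmeas.aemeasurable,
    ← mul_neg, ← integral_neg]
  · congr 1
    apply integral_congr_ae
    filter_upwards with θ
    have e : a + (c + (r : ℂ) * Complex.exp (θ * Complex.I)) • b
        = (a + c • b) + Complex.exp (θ * Complex.I) • ((r : ℂ) • b) := by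
      rw [add_smul, smul_smul, mul_comm (r : ℂ), add_assoc]
    have hm : a + (c + (r : ℂ) * Complex.exp (θ * Complex.I)) • b ∈ D := by
      apply h
      simp [abs_of_pos hr, Complex.norm_exp_ofReal_mul_I]
    rw [huf _ hm, trunc_toReal, e]
  · filter_upwards with θ
    exact lt_of_le_of_lt (min_le_right _ _) (by simp)

theorem NSuper.psh {n : ℕ} {D : Set (EuclideanSpace ℂ (Fin n))}
    {f : EuclideanSpace ℂ (Fin n) → ENNReal} (hf : NSuper f D) :
    PshOn (fun z => -(f z : EReal)) D := by
  have husc : UpperSemicontinuous (fun z => -(f z : EReal)) := by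
    have : LowerSemicontinuous (fun z => (f z : EReal)) :=
      continuous_coe_ennreal_ereal.comp_lowerSemicontinuous hf.1
        (fun x y h => by exact_mod_cast h)
    exact Continuous.comp_lowerSemicontinuous_antitone (g := fun x : EReal => -x)
      continuous_neg this (fun x y h => EReal.neg_le_neg_iff.2 h)
  refine ⟨husc.upperSemicontinuousOn D, ?_, ?_⟩
  · intro z _
    simp
  · intro a b
    refine ⟨?_, ?_⟩
    · apply UpperSemicontinuous.upperSemicontinuousOn
      exact husc.comp (by fun_prop : Continuous fun ζ : ℂ => a + ζ • b)
    · intro c r hr h m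
      rw [trunc_eq (D := D) hf.1 (fun _ _ => rfl) a b c r hr h m]
      have hc := hf.2 (a + c • b) ((r : ℂ) • b) (by
        intro ζ hζ
        have : c + ζ * r ∈ Metric.closedBall c r := by
          simp [abs_of_pos hr]
          nlinarith
        have h5 := h this
        have e : (a + c • b) + ζ • ((r : ℂ) • b) = a + (c + ζ * r) • b := by
          rw [add_smul, smul_smul, add_assoc]
        rw [e]
        exact h5)
      simp only
      by_cases htop : f (a + c • b) = ⊤
      · simp [htop]
      lift f (a + c • b) to NNReal using htop with x hx
      have h1 : (((x : NNReal) : ENNReal) : EReal) = (((x : ℝ)) : EReal) := rfl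
      rw [h1, ← EReal.coe_neg, EReal.coe_le_coe_iff, neg_le_neg_iff]
      have h2 := (lintegral_mono (fun θ => min_le_left _ (m : ENNReal))).trans hc
      have h3 := ENNReal.toReal_mono (by finiteness) h2
      rw [ENNReal.toReal_mul, ENNReal.toReal_ofReal (by positivity), ENNReal.coe_toReal] at h3
      rw [inv_mul_le_iff₀ (by positivity)]
      exact h3

/-- the nonnegative function attached to a negative one -/
noncomputable def negF {n : ℕ} (u : EuclideanSpace ℂ (Fin n) → EReal)
    (D : Set (EuclideanSpace ℂ (Fin n))) : EuclideanSpace ℂ (Fin n) → ENNReal :=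
  D.indicator (fun z => (-u z).toENNReal)

theorem negF_eq {n : ℕ} {u : EuclideanSpace ℂ (Fin n) → EReal}
    {D : Set (EuclideanSpace ℂ (Fin n))} (hu : ∀ z ∈ D, u z ≤ 0) (z) (hz : z ∈ D) :
    u z = -(negF u D z : EReal) := by
  have : (0 : EReal) ≤ - u z := by
    have := EReal.neg_le_neg_iff.2 (hu z hz)
    simpa using this
  simp [negF, hz, EReal.coe_toENNReal this]

theorem negF_lsc {n : ℕ} {u : EuclideanSpace ℂ (Fin n) → EReal}
    {D : Set (EuclideanSpace ℂ (Fin n))} (hD : IsOpen D) (hu : UpperSemicontinuousOn u D) :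
    LowerSemicontinuous (negF u D) := by
  intro x a ha
  by_cases hx : x ∈ D
  · have h2 : LowerSemicontinuousWithinAt (fun z => (-u z).toENNReal) D x := by
      refine ContinuousAt.comp_upperSemicontinuousWithinAt_antitone
        (g := fun x : EReal => (-x).toENNReal) ?_ (hu x hx) ?_
      · exact (EReal.continuous_toENNReal.comp continuous_neg).continuousAt
      · intro x y h
        exact EReal.toENNReal_le_toENNReal (EReal.neg_le_neg_iff.2 h)
    have h3 := h2 a (by simpa [negF, hx] using ha)
    rw [hD.nhdsWithin_eq hx] at h3
    filter_upwards [h3, hD.mem_nhds hx] with y hy hyD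
    simpa [negF, hyD] using hy
  · simp [negF, hx] at ha

theorem negF_super {n : ℕ} {u : EuclideanSpace ℂ (Fin n) → EReal}
    {D : Set (EuclideanSpace ℂ (Fin n))} (hD : IsOpen D) (hu : PshOn u D)
    (hu0 : ∀ z ∈ D, u z ≤ 0) : NSuper (negF u D) D := by
  have hl := negF_lsc hD hu.1
  refine ⟨hl, ?_⟩
  intro a b hab
  have ha : a ∈ D := by simpa using hab 0 (by simp)
  set f := negF u D with hfdef
  have hmeas : Measurable (fun θ : ℝ => f (a + Complex.exp (θ * Complex.I) • b)) := by
    apply hl.measurable.comp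
    apply Continuous.measurable
    fun_prop
  have key : ∀ m : ℕ, ∫⁻ θ in Ioc (0:ℝ) (2 * Real.pi),
      min (f (a + Complex.exp (θ * Complex.I) • b)) (m : ENNReal)
      ≤ ENNReal.ofReal (2 * Real.pi) * f a := by
    intro m
    have hsub : Metric.closedBall (0:ℂ) 1 ⊆ {ζ : ℂ | a + ζ • b ∈ D} := by
      intro ζ hζ
      exact hab ζ (by simpa using hζ)
    have h1 := (hu.2.2 a b).2 0 1 one_pos hsub m
    rw [trunc_eq hl (negF_eq hu0) a b 0 1 one_pos hsub m] at h1
    simp only [zero_smul, add_zero, Complex.ofReal_one, one_smul] at h1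
    rw [negF_eq hu0 a ha, ← hfdef] at h1
    by_cases htop : f a = ⊤
    · rw [htop, ENNReal.mul_top (by simp [Real.pi_pos])]
      exact le_top
    have hfin : ∫⁻ θ in Ioc (0:ℝ) (2 * Real.pi),
      min (f (a + Complex.exp (θ * Complex.I) • b)) (m : ENNReal) ≠ ⊤ := by
      apply ne_of_lt
      calc _ ≤ ∫⁻ θ in Ioc (0:ℝ) (2 * Real.pi), (m : ENNReal) :=
            lintegral_mono fun θ => min_le_right _ _
        _ < ⊤ := by
            rw [setLIntegral_const, Real.volume_Ioc]
            finiteness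
    lift f a to NNReal using htop with x hx
    have h2 : (((x : NNReal) : ENNReal) : EReal) = (((x : ℝ)) : EReal) := rfl
    rw [h2, ← EReal.coe_neg, EReal.coe_le_coe_iff, neg_le_neg_iff,
      inv_mul_le_iff₀ (by positivity)] at h1
    rw [← ENNReal.ofReal_toReal hfin]
    have := ENNReal.ofReal_le_ofReal h1
    rwa [ENNReal.ofReal_mul (by positivity), ENNReal.ofReal_coe_nnreal] at this
  have hsup : ∀ g : ENNReal, ⨆ m : ℕ, min g (m : ENNReal) = g := by
    intro g
    have h := inf_iSup_eq g (fun m : ℕ => (m : ENNReal))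
    rw [ENNReal.iSup_natCast] at h
    simpa using h.symm
  calc _ = ∫⁻ θ in Ioc (0:ℝ) (2 * Real.pi), ⨆ m : ℕ,
        min (f (a + Complex.exp (θ * Complex.I) • b)) (m : ENNReal) := by simp only [hsup]
    _ = ⨆ m : ℕ, ∫⁻ θ in Ioc (0:ℝ) (2 * Real.pi),
        min (f (a + Complex.exp (θ * Complex.I) • b)) (m : ENNReal) := by
        apply lintegral_iSup
        · intro m
          exact hmeas.min measurable_const
        · intro m k hmk θ
          exact min_le_min le_rfl (by exact_mod_cast hmk)
    _ ≤ _ := iSup_le key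

theorem NSuper.tsum {n : ℕ} {D : Set (EuclideanSpace ℂ (Fin n))}
    {f : ℕ → EuclideanSpace ℂ (Fin n) → ENNReal} (hf : ∀ j, NSuper (f j) D) :
    NSuper (fun z => ∑' j, f j z) D := by
  refine ⟨lowerSemicontinuous_tsum fun j => (hf j).1, ?_⟩
  intro a b hab
  rw [lintegral_tsum, ← ENNReal.tsum_mul_left]
  · exact ENNReal.tsum_le_tsum fun j => (hf j).2 a b hab
  · intro j
    apply Measurable.aemeasurable
    apply (hf j).1.measurable.comp
    apply Continuous.measurable
    fun_prop

theorem NSuper.mul_const {n : ℕ} {D : Set (EuclideanSpace ℂ (Fin n))}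
    {f : EuclideanSpace ℂ (Fin n) → ENNReal} (hf : NSuper f D) (c : NNReal) :
    NSuper (fun z => f z * c) D := by
  refine ⟨?_, ?_⟩
  · exact (ENNReal.continuous_mul_const (by simp)).comp_lowerSemicontinuous hf.1
      (fun x y h => mul_le_mul_left h _)
  · intro a b hab
    rw [lintegral_mul_const' _ _ (by simp), ← mul_assoc]
    gcongr
    exact hf.2 a b hab

/-- Mean value inequality on balls. -/
theorem NSuper.mean {n : ℕ} {D : Set (EuclideanSpace ℂ (Fin n))}
    {f : EuclideanSpace ℂ (Fin n) → ENNReal} (hf : NSuper f D)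
    (z : EuclideanSpace ℂ (Fin n)) (r : ℝ) (hr : ball z r ⊆ D) :
    ∫⁻ y in ball z r, f y ≤ volume (ball z r) * f z := by
  let B := ball (0 : EuclideanSpace ℂ (Fin n)) r
  have hP : ENNReal.ofReal (2 * Real.pi) ≠ 0 := by simp [Real.pi_pos]
  have htr : ∀ g : EuclideanSpace ℂ (Fin n) → ENNReal,
      ∫⁻ y in ball z r, g y = ∫⁻ y in B, g (z + y) := by
    intro g
    rw [← lintegral_indicator measurableSet_ball, ← lintegral_indicator measurableSet_ball,
      ← lintegral_add_left_eq_self _ z]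
    congr 1
    ext y
    simp [indicator, mem_ball, dist_eq_norm, B]
  have hrot : ∀ θ : ℝ, ∫⁻ y in B, f (z + Complex.exp (θ * Complex.I) • y)
      = ∫⁻ y in B, f (z + y) := by
    intro θ
    have hn : ‖Complex.exp (θ * Complex.I)‖ = 1 := Complex.norm_exp_ofReal_mul_I θ
    let L : EuclideanSpace ℂ (Fin n) ≃ₗᵢ[ℝ] EuclideanSpace ℂ (Fin n) :=
      { toLinearEquiv := (LinearEquiv.smulOfNeZero ℂ (EuclideanSpace ℂ (Fin n))
          (Complex.exp (θ * Complex.I)) (Complex.exp_ne_zero _)).restrictScalars ℝ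
        norm_map' := fun x => by
          show ‖Complex.exp (θ * Complex.I) • x‖ = ‖x‖
          rw [norm_smul, hn, one_mul] }
    have hL : ∀ x, L x = Complex.exp (θ * Complex.I) • x := fun _ => rfl
    have hmp : MeasurePreserving L volume volume := L.measurePreserving
    rw [← lintegral_indicator measurableSet_ball, ← lintegral_indicator measurableSet_ball,
      ← hmp.lintegral_comp (f := B.indicator fun y => f (z + y))]
    · congr 1
      ext y
      simp [indicator, B, hL, norm_smul, hn]
    · apply Measurable.indicator _ measurableSet_ball
      apply hf.1.measurable.comp
      fun_prop
  rw [htr]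
  have hvol : volume (ball z r) = volume B := by
    have := htr (fun _ => 1)
    simpa using this
  rw [hvol]
  have h1 : ENNReal.ofReal (2 * Real.pi) * ∫⁻ y in B, f (z + y) =
      ∫⁻ θ in Ioc (0:ℝ) (2 * Real.pi), ∫⁻ y in B, f (z + Complex.exp (θ * Complex.I) • y) := by
    simp only [hrot]
    rw [setLIntegral_const, Real.volume_Ioc, sub_zero, mul_comm]
  have h2 : ∫⁻ θ in Ioc (0:ℝ) (2 * Real.pi),
      ∫⁻ y in B, f (z + Complex.exp (θ * Complex.I) • y) =
      ∫⁻ y in B, ∫⁻ θ in Ioc (0:ℝ) (2 * Real.pi), f (z + Complex.exp (θ * Complex.I) • y) := by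
    apply lintegral_lintegral_swap
    apply Measurable.aemeasurable
    apply hf.1.measurable.comp
    apply Continuous.measurable
    fun_prop
  have h3 : ∫⁻ y in B, ∫⁻ θ in Ioc (0:ℝ) (2 * Real.pi),
      f (z + Complex.exp (θ * Complex.I) • y) ≤
      ∫⁻ y in B, ENNReal.ofReal (2 * Real.pi) * f z := by
    apply setLIntegral_mono' measurableSet_ball
    intro y hy
    apply hf.2
    intro ζ hζ
    apply hr
    have hy' : ‖y‖ < r := by simpa [B] using hy
    simp only [mem_ball, dist_eq_norm, add_sub_cancel_left, norm_smul]
    nlinarith [norm_nonneg y]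
  rw [setLIntegral_const] at h3
  rw [← ENNReal.mul_le_mul_iff_right hP ENNReal.ofReal_ne_top, h1, h2]
  refine h3.trans (le_of_eq ?_)
  ring

theorem NSuper.measure_lt {n : ℕ} {D : Set (EuclideanSpace ℂ (Fin n))}
    {f : EuclideanSpace ℂ (Fin n) → ENNReal} (hf : NSuper f D)
    (z : EuclideanSpace ℂ (Fin n)) (r : ℝ) (hr : ball z r ⊆ D) (t : ENNReal) :
    t * volume (ball z r ∩ {y | t ≤ f y}) ≤ volume (ball z r) * f z := by
  refine le_trans ?_ (hf.mean z r hr)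
  have := mul_meas_ge_le_lintegral (μ := volume.restrict (ball z r)) hf.1.measurable t
  rwa [Measure.restrict_apply (measurableSet_le measurable_const hf.1.measurable),
    inter_comm] at this

/-- The infinity set of a nontrivial function is null. -/
theorem NSuper.null {n : ℕ} {D : Set (EuclideanSpace ℂ (Fin n))} (hD : IsBddDomain D)
    {f : EuclideanSpace ℂ (Fin n) → ENNReal} (hf : NSuper f D)
    (hne : ∃ z ∈ D, f z ≠ ⊤) : volume (D ∩ {y | f y = ⊤}) = 0 := by
  obtain ⟨hDo, hDc, hDb⟩ := hD
  have hball : ∀ z r, ball z r ⊆ D → f z ≠ ⊤ → volume (ball z r ∩ {y | f y = ⊤}) = 0 := by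
    intro z r hr hz
    by_contra hcon
    have := hf.measure_lt z r hr ⊤
    simp only [top_le_iff] at this
    rw [ENNReal.top_mul hcon, top_le_iff] at this
    exact ENNReal.mul_ne_top measure_ball_lt_top.ne hz this
  let W : Set (EuclideanSpace ℂ (Fin n)) := {x | ∃ r > 0, volume (ball x r ∩ {y | f y = ⊤}) = 0}
  have hWo : IsOpen W := by
    rw [Metric.isOpen_iff]
    rintro x ⟨r, hr, hx⟩
    refine ⟨r / 2, by positivity, fun y hy => ⟨r / 2, by positivity, ?_⟩⟩
    refine measure_mono_null (inter_subset_inter_left _ ?_) hx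
    apply ball_subset_ball'
    rw [mem_ball] at hy
    linarith
  have hsub : D ⊆ W := by
    apply hDc.isPreconnected.subset_of_closure_inter_subset hWo
    · obtain ⟨z, hz, hfz⟩ := hne
      obtain ⟨r, hr, hrD⟩ := Metric.isOpen_iff.1 hDo z hz
      exact ⟨z, hz, r, hr, hball z r hrD hfz⟩
    · rintro x ⟨hxc, hxD⟩
      obtain ⟨r, hr, hrD⟩ := Metric.isOpen_iff.1 hDo x hxD
      obtain ⟨w, hwW, hwx⟩ := Metric.mem_closure_iff.1 hxc (r / 4) (by positivity)
      obtain ⟨s, hs, hws⟩ := hwW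
      have : ∃ z ∈ ball w (min s (r / 4)), f z ≠ ⊤ := by
        by_contra! hall
        have h0 : volume (ball w (min s (r / 4))) = 0 := by
          refine measure_mono_null ?_ hws
          intro y hy
          exact ⟨ball_subset_ball (min_le_left _ _) hy, hall y hy⟩
        exact (measure_ball_pos volume w (by positivity : 0 < min s (r / 4))).ne' h0
      obtain ⟨z, hz, hfz⟩ := this
      have hzw : dist z w < r / 4 := lt_of_lt_of_le (mem_ball.1 hz) (min_le_right _ _)
      have hzx : dist z x < r / 2 := by
        have := dist_triangle z w x
        rw [dist_comm w x] at this
        linarith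
      have hz2 : ball z (r / 2) ⊆ D := (ball_subset_ball' (by linarith)).trans hrD
      exact hWo.mem_nhds_iff.1 (by
        apply mem_of_superset (hWo.mem_nhds ?_) (le_refl W)
        have h0 := hball z _ hz2 hfz
        refine ⟨r / 2 - dist z x, by linarith, measure_mono_null (inter_subset_inter_left _ ?_) h0⟩
        apply ball_subset_ball'
        rw [dist_comm x z]
        linarith)
  refine measure_null_of_locally_null _ ?_
  rintro x ⟨hxD, -⟩
  obtain ⟨r, hr, hx⟩ := hsub hxD
  refine ⟨ball x r ∩ (D ∩ {y | f y = ⊤}), ?_, ?_⟩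
  · rw [inter_comm (ball x r)]
    exact inter_mem_nhdsWithin _ (ball_mem_nhds x hr)
  · exact measure_mono_null (inter_subset_inter_right _ inter_subset_right) hx

theorem bndExt_le {n : ℕ} {D A : Set (EuclideanSpace ℂ (Fin n))}
    {z : EuclideanSpace ℂ (Fin n)} (hz : z ∈ D) : bndExt z A D ≤ 0 := by
  apply sSup_le
  rintro w ⟨u, -, hu, -, rfl⟩
  exact hu z hz

theorem le_bndExt {n : ℕ} {D A : Set (EuclideanSpace ℂ (Fin n))}
    {u : EuclideanSpace ℂ (Fin n) → EReal} (hu : MemPSH u D) (hu0 : ∀ y ∈ D, u y ≤ 0)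
    (huA : ∀ x ∈ A, uscReg u D x ≤ -1) (z : EuclideanSpace ℂ (Fin n)) :
    u z ≤ bndExt z A D :=
  le_sSup ⟨u, hu, hu0, huA, rfl⟩

/-- Where the regularization vanishes, the extremal function vanishes almost everywhere. -/
theorem bndExt_ae {n : ℕ} {D A : Set (EuclideanSpace ℂ (Fin n))} (hD : IsBddDomain D)
    (h : ∀ x ∈ closure D, bndExtStar x A D = 0) :
    volume (D ∩ {y | bndExt y A D < 0}) = 0 := by
  have hδ : ∀ δ : ℝ, 0 < δ → volume (D ∩ {y | bndExt y A D < ((-δ : ℝ) : EReal)}) = 0 := by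
    intro δ hδ
    refine measure_null_of_locally_null _ ?_
    rintro x ⟨hxD, -⟩
    obtain ⟨r, hr, hrD⟩ := Metric.isOpen_iff.1 hD.1 x hxD
    refine ⟨ball x (r / 2) ∩ (D ∩ {y | bndExt y A D < ((-δ : ℝ) : EReal)}), ?_, ?_⟩
    · rw [inter_comm (ball x (r / 2))]
      exact inter_mem_nhdsWithin _ (ball_mem_nhds x (by positivity))
    set S := ball x (r / 2) ∩ (D ∩ {y | bndExt y A D < ((-δ : ℝ) : EReal)})
    have hbound : ∀ ε : NNReal, 0 < ε →
        ENNReal.ofReal δ * volume S ≤ volume (ball x r) * ε := by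
      intro ε hε
      have hfr : ∃ᶠ z in 𝓝[D] x, ((-(ε : ℝ) : ℝ) : EReal) < bndExt z A D := by
        apply frequently_lt_of_lt_limsup
        · isBoundedDefault
        · have := h x (subset_closure hxD)
          unfold bndExtStar at this
          rw [this]
          exact_mod_cast neg_lt_zero.2 (NNReal.coe_pos.2 hε)
      have hev : ∀ᶠ z in 𝓝[D] x, z ∈ D ∩ ball x (r / 4) :=
        inter_mem_nhdsWithin _ (ball_mem_nhds x (by positivity))
      obtain ⟨z, hz, hzD, hzx⟩ := (hfr.and_eventually hev).exists
      obtain ⟨w, ⟨u, hu, hu0, huA, rfl⟩, hw⟩ := lt_sSup_iff.1 hz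
      have hf := negF_super hD.1 hu.1 hu0
      rw [mem_ball] at hzx
      have hzr : ball z (3 * r / 4) ⊆ ball x r := ball_subset_ball' (by linarith)
      have hfz : negF u D z ≤ ε := by
        rw [negF_eq hu0 z hzD] at hw
        have h2 : ((-(ε : ℝ) : ℝ) : EReal) = -(((ε : NNReal) : ENNReal) : EReal) := rfl
        rw [h2, EReal.neg_lt_neg_iff] at hw
        exact_mod_cast hw.le
      have hm := hf.measure_lt z (3 * r / 4) (hzr.trans hrD) (ENNReal.ofReal δ)
      calc ENNReal.ofReal δ * volume S ≤ ENNReal.ofReal δ *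
            volume (ball z (3 * r / 4) ∩ {y | ENNReal.ofReal δ ≤ negF u D y}) := by
            gcongr
            rintro y ⟨hy1, hyD, hy2⟩
            refine ⟨ball_subset_ball' (by rw [dist_comm]; linarith) hy1, ?_⟩
            have h3 : u y < ((-δ : ℝ) : EReal) := lt_of_le_of_lt
              (le_bndExt hu hu0 huA y) hy2
            rw [negF_eq hu0 y hyD] at h3
            have h2 : ((-δ : ℝ) : EReal) = -((ENNReal.ofReal δ : ENNReal) : EReal) := by
              rw [EReal.coe_ennreal_ofReal, max_eq_left hδ.le, EReal.coe_neg]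
            rw [h2, EReal.neg_lt_neg_iff] at h3
            exact_mod_cast h3.le
        _ ≤ _ := hm
        _ ≤ _ := by gcongr
    have hz : ENNReal.ofReal δ * volume S = 0 := by
      by_contra hcon
      have hV : volume (ball x r) ≠ ⊤ := measure_ball_lt_top.ne
      obtain ⟨c, hc, hc2⟩ := ENNReal.exists_nnreal_pos_mul_lt hV hcon
      have := hbound c hc
      rw [mul_comm] at hc2
      exact absurd this (not_le.2 hc2)
    rcases mul_eq_zero.1 hz with h0 | h0
    · simp at h0
      linarith
    · exact h0
  have hU : D ∩ {y | bndExt y A D < 0} ⊆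
      ⋃ k : ℕ, D ∩ {y | bndExt y A D < ((-(1 / ((k : ℝ) + 1)) : ℝ) : EReal)} := by
    rintro y ⟨hyD, hy⟩
    simp only [mem_ofPred_eq] at hy
    obtain ⟨q, hq1, hq2⟩ := EReal.lt_iff_exists_real_btwn.1 hy
    have hq : q < 0 := by exact_mod_cast hq2
    obtain ⟨k, hk⟩ := exists_nat_one_div_lt (neg_pos.2 hq)
    refine mem_iUnion.2 ⟨k, hyD, hq1.trans ?_⟩
    exact EReal.coe_lt_coe_iff.2 (by linarith)
  refine measure_mono_null hU (measure_iUnion_null fun k => hδ _ (by positivity))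

theorem uscReg_mono {n : ℕ} {D : Set (EuclideanSpace ℂ (Fin n))}
    {u v : EuclideanSpace ℂ (Fin n) → EReal} (h : ∀ z ∈ D, u z ≤ v z)
    (x : EuclideanSpace ℂ (Fin n)) : uscReg u D x ≤ uscReg v D x := by
  have hev : u ≤ᶠ[𝓝[D] x] v := by
    filter_upwards [self_mem_nhdsWithin] with z hz using h z hz
  exact limsup_le_limsup hev

/-- If `ω*(·, A j, D) ≡ 0` for every `j`, then
`ω*(·, ⋃ j, A j, D) ≡ 0`; consequently a countable union of b-pluripolar subsets of `∂D`
is b-pluripolar. -/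
theorem bndExtStar_iUnion_eq_zero {n : ℕ}
    (D : Set (EuclideanSpace ℂ (Fin n))) (hD : IsBddDomain D)
    (A : ℕ → Set (EuclideanSpace ℂ (Fin n))) (hA : ∀ j, A j ⊆ frontier D) :
    ((∀ j, ∀ x ∈ closure D, bndExtStar x (A j) D = 0) →
      ∀ x ∈ closure D, bndExtStar x (⋃ j, A j) D = 0) ∧
    ((∀ j, BPluripolar (A j) D) → BPluripolar (⋃ j, A j) D) := by
  have hneg : ∀ g : ENNReal, -(g : EReal) ≤ 0 := by
    intro g
    have := EReal.neg_le_neg_iff.2 (EReal.coe_ennreal_nonneg g)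
    simpa using this
  refine ⟨?_, ?_⟩
  · intro h x hx
    have hnull : volume (⋃ j, D ∩ {y | bndExt y (A j) D < 0}) = 0 :=
      measure_iUnion_null fun j => bndExt_ae hD (h j)
    have hgood : ∀ z ∈ D, z ∉ (⋃ j, D ∩ {y | bndExt y (A j) D < 0}) →
        0 ≤ bndExt z (⋃ j, A j) D := by
      intro z hz hzn
      refine EReal.ge_of_forall_gt_iff_ge.1 ?_
      intro q hq
      have hq0 : 0 < -q := by
        have : q < 0 := by exact_mod_cast hq
        linarith
      obtain ⟨ε, hε, hεs⟩ := ENNReal.exists_pos_sum_of_countable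
        (ε := ENNReal.ofReal (-q)) (by simpa using hq0) ℕ
      have hex : ∀ j, ∃ u : EuclideanSpace ℂ (Fin n) → EReal, MemPSH u D ∧
          (∀ y ∈ D, u y ≤ 0) ∧ (∀ x ∈ A j, uscReg u D x ≤ -1) ∧ negF u D z ≤ ε j := by
        intro j
        have hj : 0 ≤ bndExt z (A j) D := by
          by_contra hcon
          exact hzn (mem_iUnion.2 ⟨j, hz, not_le.1 hcon⟩)
        have hlt : ((-(ε j : ℝ) : ℝ) : EReal) < bndExt z (A j) D := by
          refine lt_of_lt_of_le ?_ hj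
          exact_mod_cast neg_lt_zero.2 (NNReal.coe_pos.2 (hε j))
        obtain ⟨w, ⟨u, hu, hu0, huA, rfl⟩, hw⟩ := lt_sSup_iff.1 hlt
        refine ⟨u, hu, hu0, huA, ?_⟩
        rw [negF_eq hu0 z hz] at hw
        have h2 : ((-(ε j : ℝ) : ℝ) : EReal) = -(((ε j : NNReal) : ENNReal) : EReal) := rfl
        rw [h2, EReal.neg_lt_neg_iff] at hw
        exact_mod_cast hw.le
      choose u hu hu0 huA huz using hex
      have hF : NSuper (fun y => ∑' j, negF (u j) D y) D :=
        NSuper.tsum fun j => negF_super hD.1 (hu j).1 (hu0 j)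
      have hFz : ∑' j, negF (u j) D z < ENNReal.ofReal (-q) :=
        lt_of_le_of_lt (ENNReal.tsum_le_tsum huz) hεs
      have hqF : (q : EReal) ≤ -((∑' j, negF (u j) D z : ENNReal) : EReal) := by
        have h2 : (q : EReal) = -((ENNReal.ofReal (-q) : ENNReal) : EReal) := by
          rw [EReal.coe_ennreal_ofReal, max_eq_left hq0.le, EReal.coe_neg, neg_neg]
        rw [h2, EReal.neg_le_neg_iff]
        exact_mod_cast hFz.le
      refine hqF.trans (le_bndExt (u := fun y => -((∑' j, negF (u j) D y : ENNReal) : EReal))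
        ⟨hF.psh, z, hz, ?_⟩ (fun y _ => hneg _) ?_ z)
      · simpa using (hFz.trans ENNReal.ofReal_lt_top).ne
      · intro x hx
        obtain ⟨j, hj⟩ := mem_iUnion.1 hx
        refine (uscReg_mono ?_ x).trans (huA j x hj)
        intro y hy
        rw [negF_eq (hu0 j) y hy, EReal.neg_le_neg_iff]
        exact_mod_cast ENNReal.le_tsum j
    have : (𝓝[D] x).NeBot := mem_closure_iff_nhdsWithin_neBot.1 hx
    apply le_antisymm
    · apply limsup_le_of_le
      · isBoundedDefault
      · filter_upwards [self_mem_nhdsWithin] with z hz using bndExt_le hz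
    · apply le_limsup_of_frequently_le
      · rw [Filter.frequently_iff]
        intro U hU
        obtain ⟨V, hVo, hxV, hVU⟩ := mem_nhdsWithin.1 hU
        have hne : (V ∩ D).Nonempty := mem_closure_iff.1 hx V hVo hxV
        have hpos := (hVo.inter hD.1).measure_pos volume hne
        by_contra! hcon
        refine hpos.ne' (measure_mono_null ?_ hnull)
        intro y hy
        by_contra hy2
        exact absurd (hgood y hy.2 hy2) (not_le.2 (hcon y (hVU hy)))
      · isBoundedDefault
  · intro h
    choose u hu hu0 hune huA using h
    have hnull : volume (⋃ j, D ∩ {y | negF (u j) D y = ⊤}) = 0 := by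
      apply measure_iUnion_null
      intro j
      apply (negF_super hD.1 (hu j) (hu0 j)).null hD
      obtain ⟨z, hz, hne⟩ := hune j
      refine ⟨z, hz, ?_⟩
      intro htop
      apply hne
      rw [negF_eq (hu0 j) z hz, htop]
      rfl
    have hpos := hD.1.measure_pos volume hD.2.1.nonempty
    obtain ⟨z, hz, hzn⟩ : ∃ z ∈ D, z ∉ ⋃ j, D ∩ {y | negF (u j) D y = ⊤} := by
      by_contra! hcon
      exact hpos.ne' (measure_mono_null hcon hnull)
    have hfin : ∀ j, negF (u j) D z ≠ ⊤ := by
      intro j hj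
      exact hzn (mem_iUnion.2 ⟨j, hz, hj⟩)
    obtain ⟨c, hc, hcs⟩ := ENNReal.exists_pos_tsum_mul_lt_of_countable one_ne_zero _ hfin
    have hF : NSuper (fun y => ∑' j, negF (u j) D y * c j) D :=
      NSuper.tsum fun j => (negF_super hD.1 (hu j) (hu0 j)).mul_const (c j)
    refine ⟨fun y => -((∑' j, negF (u j) D y * c j : ENNReal) : EReal), hF.psh,
      fun y _ => hneg _, ⟨z, hz, ?_⟩, ?_⟩
    · simpa using (hcs.trans ENNReal.one_lt_top).ne
    · intro x hx
      obtain ⟨j, hj⟩ := mem_iUnion.1 hx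
      have hlim := huA j x hj
      rw [eq_bot_iff]
      refine EReal.le_of_forall_lt_iff_le.1 ?_
      intro M _
      apply limsup_le_of_le
      · isBoundedDefault
      have hev : ∀ᶠ y in 𝓝[D] x, u j y < ((-(max (-M) 0 / c j) : ℝ) : EReal) := by
        apply eventually_lt_of_limsup_lt
        · have : limsup (u j) (𝓝[D] x) = ⊥ := hlim
          rw [this]
          exact EReal.bot_lt_coe _
        · isBoundedDefault
      filter_upwards [hev, self_mem_nhdsWithin] with y hy hyD
      have hcj : (0:ℝ) < c j := hc j
      rw [negF_eq (hu0 j) y hyD] at hy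
      have h2 : ((-(max (-M) 0 / c j) : ℝ) : EReal)
          = -((ENNReal.ofReal (max (-M) 0 / c j) : ENNReal) : EReal) := by
        have hnn : 0 ≤ max (-M) 0 / (c j : ℝ) := by positivity
        rw [EReal.coe_ennreal_ofReal, max_eq_left hnn, EReal.coe_neg]
      rw [h2, EReal.neg_lt_neg_iff] at hy
      have hy' : ENNReal.ofReal (max (-M) 0 / c j) ≤ negF (u j) D y := by exact_mod_cast hy.le
      have h3 : ENNReal.ofReal (max (-M) 0) ≤ ∑' j, negF (u j) D y * c j := by
        refine le_trans ?_ (ENNReal.le_tsum j)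
        calc ENNReal.ofReal (max (-M) 0)
            = ENNReal.ofReal (max (-M) 0 / c j) * c j := by
              rw [← ENNReal.ofReal_coe_nnreal, ← ENNReal.ofReal_mul (by positivity),
                div_mul_cancel₀ _ hcj.ne']
          _ ≤ _ := by gcongr
      have h4 : -((∑' j, negF (u j) D y * c j : ENNReal) : EReal)
          ≤ -((ENNReal.ofReal (max (-M) 0) : ENNReal) : EReal) :=
        EReal.neg_le_neg_iff.2 (by exact_mod_cast h3)
      refine h4.trans ?_
      rw [EReal.coe_ennreal_ofReal, max_eq_left (le_max_right _ _), ← EReal.coe_neg,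
        EReal.coe_le_coe_iff]
      linarith [le_max_left (-M) 0]
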